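/- For 0 ≤ i ≤ n−1, the unique parking function of length n with statistic encoding A^i T^{n-1-i} is α = (1, 2, …, i, i+1, i+1, …, i+1), whose first i entries are 1, 2, …, i and whose last n−i entries all equal i+1; and the unique parking function of length n with statistic encoding T^{n-1-i} D^{i} is its reverse (i+1, …, i+1, i, i−1, …, 2, 1). -/

import Mathlib

open scoped Classical

/-- `f : Fin n → Fin n` (entries 0-indexed, value `v` encodes preference `v+1`) is a
parking function: some rearrangement `f ∘ σ` is nondecreasing and its `i`-th entry
(0-indexed) is at most `i`. -/
def IsPF {n : ℕ} (f : Fin n → Fin n) : Prop :=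
  ∃ σ : Equiv.Perm (Fin n), Monotone (f ∘ σ) ∧ ∀ i : Fin n, (f (σ i) : ℕ) ≤ (i : ℕ)

/-- The alphabet {A, D, T}: ascent, descent, tie. -/
inductive Letter : Type
  | A : Letter
  | D : Letter
  | T : Letter
deriving DecidableEq

/-- The statistic encoding of a tuple `a_1, …, a_n`: the word `w_1 ⋯ w_{n-1}` with
`w_i = A` if `a_i < a_{i+1}`, `w_i = D` if `a_i > a_{i+1}`, and `w_i = T` if
`a_i = a_{i+1}`.  (Position `i` of the word is the entry at `Fin`-index `i - 1`.) -/
def statEnc {n : ℕ} (f : Fin n → Fin n) : Fin (n - 1) → Letter := fun i =>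
  if f ⟨(i : ℕ), by have := i.isLt; omega⟩ < f ⟨(i : ℕ) + 1, by have := i.isLt; omega⟩ then
    Letter.A
  else if f ⟨(i : ℕ) + 1, by have := i.isLt; omega⟩ < f ⟨(i : ℕ), by have := i.isLt; omega⟩ then
    Letter.D
  else Letter.T

theorem statEnc_eq_A_iff {n : ℕ} (f : Fin n → Fin n) (j : ℕ) (hj : j < n - 1) :
    statEnc f ⟨j, hj⟩ = Letter.A ↔ f ⟨j, by omega⟩ < f ⟨j + 1, by omega⟩ := by
  unfold statEnc
  split_ifs <;> simp_all

theorem statEnc_eq_D_iff {n : ℕ} (f : Fin n → Fin n) (j : ℕ) (hj : j < n - 1) :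
    statEnc f ⟨j, hj⟩ = Letter.D ↔ f ⟨j + 1, by omega⟩ < f ⟨j, by omega⟩ := by
  unfold statEnc
  split_ifs with h₁ h₂ <;> simp_all [le_of_lt]

theorem statEnc_eq_T_iff {n : ℕ} (f : Fin n → Fin n) (j : ℕ) (hj : j < n - 1) :
    statEnc f ⟨j, hj⟩ = Letter.T ↔ f ⟨j, by omega⟩ = f ⟨j + 1, by omega⟩ := by
  unfold statEnc
  split_ifs with h₁ h₂
  · simpa using h₁.ne
  · simpa using h₂.ne'
  · simpa using le_antisymm (not_lt.1 h₂) (not_lt.1 h₁)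

/-- Parking functions are stable under permuting their entries. -/
theorem IsPF.comp_perm {n : ℕ} {f : Fin n → Fin n} (hf : IsPF f) (τ : Equiv.Perm (Fin n)) :
    IsPF (f ∘ τ) := by
  obtain ⟨σ, hσ, hle⟩ := hf
  refine ⟨σ.trans τ.symm, ?_, fun k => ?_⟩
  · simpa [Function.comp_def] using hσ
  · simpa using hle k

/-- A monotone tuple is a parking function exactly when its entries satisfy the defining bound. -/
theorem isPF_iff_of_monotone {n : ℕ} {f : Fin n → Fin n} (hf : Monotone f) :
    IsPF f ↔ ∀ k, f k ≤ k := by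
  constructor
  · rintro ⟨σ, hσ, hle⟩ k
    have h : f ∘ σ = f ∘ Equiv.refl (Fin n) := Tuple.unique_monotone hσ (by simpa using hf)
    have hk := congrFun h k
    simp only [Function.comp_apply, Equiv.refl_apply] at hk
    rw [← hk]
    exact hle k
  · exact fun h => ⟨Equiv.refl _, by simpa using hf, fun k => h k⟩

theorem monotone_of_statEnc_ne_D {n : ℕ} {f : Fin n → Fin n}
    (h : ∀ j, statEnc f j ≠ Letter.D) : Monotone f := by
  cases n with
  | zero => exact fun a => a.elim0
  | succ m =>
    refine Fin.monotone_iff_le_succ.2 fun j => ?_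
    have hj := h ⟨j, by simp⟩
    rw [Ne, statEnc_eq_D_iff, not_lt] at hj
    exact hj

theorem isPF_and_statEnc_ascents_ties_iff {n i : ℕ} (hi : i < n)
    (f : Fin n → Fin n) :
    (IsPF f ∧ statEnc f = fun j : Fin (n - 1) => if (j : ℕ) < i then Letter.A else Letter.T) ↔
      f = fun k : Fin n => if (k : ℕ) < i then k else ⟨i, hi⟩ := by
  constructor
  · rintro ⟨hpf, henc⟩
    have hmono : Monotone f := monotone_of_statEnc_ne_D fun j => by
      rw [henc]; dsimp only; split_ifs <;> simp
    have hle := (isPF_iff_of_monotone hmono).1 hpf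
    have key : ∀ (k : ℕ) (hk : k < n), (f ⟨k, hk⟩ : ℕ) = min k i := by
      intro k
      induction k with
      | zero => intro hk; have := Fin.le_def.1 (hle ⟨0, hk⟩); simp at this ⊢; omega
      | succ k ih =>
        intro hk
        have hprev := ih (by omega)
        have hbound := Fin.le_def.1 (hle ⟨k + 1, hk⟩)
        have hw := congrFun henc ⟨k, by omega⟩
        dsimp only at hw hbound
        split_ifs at hw with hki
        · have := Fin.lt_def.1 ((statEnc_eq_A_iff f k (by omega)).1 hw)
          omega
        · have := congrArg Fin.val ((statEnc_eq_T_iff f k (by omega)).1 hw)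
          omega
    funext k
    apply Fin.ext
    rw [key k k.isLt]
    split_ifs with hk
    · exact min_eq_left hk.le
    · exact min_eq_right (not_lt.1 hk)
  · rintro rfl
    have henc : statEnc (fun k : Fin n => if (k : ℕ) < i then k else ⟨i, hi⟩) =
        fun j : Fin (n - 1) => if (j : ℕ) < i then Letter.A else Letter.T := by
      funext ⟨j, hj⟩
      dsimp only
      split_ifs with hji
      · rw [statEnc_eq_A_iff, Fin.lt_def]
        dsimp only
        split_ifs <;> grind
      · rw [statEnc_eq_T_iff, Fin.ext_iff]
        dsimp only
        split_ifs <;> grind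
    refine ⟨(isPF_iff_of_monotone (monotone_of_statEnc_ne_D fun j => ?_)).2 fun k => ?_, henc⟩
    · rw [henc]; dsimp only; split_ifs <;> simp
    · split_ifs with hk
      · exact le_rfl
      · exact Fin.le_def.2 (not_lt.1 hk)

theorem isPF_comp_rev_iff {n : ℕ} {f : Fin n → Fin n} : IsPF (f ∘ Fin.rev) ↔ IsPF f := by
  refine ⟨fun h => ?_, fun h => h.comp_perm Fin.revPerm⟩
  simpa [Function.comp_def] using h.comp_perm Fin.revPerm

/-- The letter describing a step traversed backwards. -/
def Letter.swap : Letter → Letter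
  | A => D
  | D => A
  | T => T

theorem Letter.swap_injective : Function.Injective Letter.swap := by
  intro a b h
  cases a <;> cases b <;> simp_all [Letter.swap]

theorem statEnc_comp_rev {n : ℕ} (f : Fin n → Fin n) (j : Fin (n - 1)) :
    statEnc (f ∘ Fin.rev) j = (statEnc f j.rev).swap := by
  obtain ⟨j, hj⟩ := j
  have h₁ : Fin.rev (⟨j, by omega⟩ : Fin n) = ⟨n - 1 - (j + 1) + 1, by omega⟩ :=
    Fin.ext (by simp [Fin.val_rev]; omega)
  have h₂ : Fin.rev (⟨j + 1, by omega⟩ : Fin n) = ⟨n - 1 - (j + 1), by omega⟩ :=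
    Fin.ext (by simp [Fin.val_rev]; omega)
  have h₃ : Fin.rev (⟨j, hj⟩ : Fin (n - 1)) = ⟨n - 1 - (j + 1), by omega⟩ :=
    Fin.ext (by simp [Fin.val_rev])
  rw [h₃]
  cases h : statEnc f ⟨n - 1 - (j + 1), by omega⟩
  · rw [statEnc_eq_A_iff] at h
    rw [Letter.swap, statEnc_eq_D_iff]
    simpa only [Function.comp_apply, h₁, h₂] using h
  · rw [statEnc_eq_D_iff] at h
    rw [Letter.swap, statEnc_eq_A_iff]
    simpa only [Function.comp_apply, h₁, h₂] using h
  · rw [statEnc_eq_T_iff] at h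
    rw [Letter.swap, statEnc_eq_T_iff]
    simpa only [Function.comp_apply, h₁, h₂] using h.symm

theorem statEnc_comp_rev_eq_iff {n : ℕ} (f : Fin n → Fin n) (w : Fin (n - 1) → Letter) :
    (statEnc (f ∘ Fin.rev) = fun j => (w j.rev).swap) ↔ statEnc f = w := by
  constructor
  · intro h
    funext j
    have hj := congrFun h j.rev
    rw [statEnc_comp_rev] at hj
    simpa using Letter.swap_injective hj
  · rintro rfl
    exact funext (statEnc_comp_rev f)

/-- For `0 ≤ i ≤ n-1`: the unique parking function of length `n` with statistic encoding
`A^i T^{n-1-i}` is `(1, 2, …, i, i+1, i+1, …, i+1)`, and the unique parking function of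
length `n` with statistic encoding `T^{n-1-i} D^i` is its reverse
`(i+1, …, i+1, i, i-1, …, 2, 1)`.  (Entries are 0-indexed: value `v` encodes `v+1`.) -/
theorem stmt14 (n i : ℕ) (hn : 1 ≤ n) (hi : i ≤ n - 1) :
    (∀ f : Fin n → Fin n,
      (IsPF f ∧ statEnc f = fun j : Fin (n - 1) =>
          if (j : ℕ) < i then Letter.A else Letter.T) ↔
        f = fun k : Fin n => if (k : ℕ) < i then k else ⟨i, by omega⟩) ∧
    (∀ f : Fin n → Fin n,
      (IsPF f ∧ statEnc f = fun j : Fin (n - 1) =>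
          if (j : ℕ) < n - 1 - i then Letter.T else Letter.D) ↔
        f = fun k : Fin n =>
          if n - 1 - (k : ℕ) < i then ⟨n - 1 - (k : ℕ), by omega⟩ else ⟨i, by omega⟩) := by
  refine ⟨isPF_and_statEnc_ascents_ties_iff (by omega), fun f => ?_⟩
  have hword : (fun j : Fin (n - 1) => if (j : ℕ) < i then Letter.A else Letter.T) =
      fun j : Fin (n - 1) =>
        (if (j.rev : ℕ) < n - 1 - i then Letter.T else Letter.D).swap := by
    funext j
    have hj := j.isLt
    have hrev : (j.rev : ℕ) < n - 1 - i ↔ ¬ (j : ℕ) < i := by rw [Fin.val_rev]; omega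
    simp only [hrev]
    split_ifs <;> rfl
  have hmain := isPF_and_statEnc_ascents_ties_iff (show i < n by omega) (f ∘ Fin.rev)
  rw [hword, isPF_comp_rev_iff, statEnc_comp_rev_eq_iff f
    (fun j : Fin (n - 1) => if (j : ℕ) < n - 1 - i then Letter.T else Letter.D)] at hmain
  rw [hmain]
  have hval (k : Fin n) : (k.rev : ℕ) = n - 1 - (k : ℕ) := by rw [Fin.val_rev]; omega
  constructor
  · intro h
    funext k
    have hk := congrFun h k.rev
    simp only [Function.comp_apply, Fin.rev_rev] at hk
    rw [hk]
    simp only [hval]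
    split_ifs
    · exact Fin.ext (hval k)
    · rfl
  · rintro rfl
    funext k
    have hk : n - 1 - (n - 1 - (k : ℕ)) = k := by have := k.isLt; omega
    simp only [Function.comp_apply, hval, hk]
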